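/- Terminating A_n very-well-poised ₆φ₅ summation: Let n be a positive integer, N a nonnegative integer, q a nonzero complex number that is not a root of unity, a, b, c_1, …, c_n complex numbers, and x_1, …, x_n nonzero complex numbers, all generic so that no denominator below vanishes. Then ∑_{k_1,…,k_n ≥ 0, |k| ≤ N} [ ∏_{1≤i<j≤n} (x_i·q^{k_i} − x_j·q^{k_j})/(x_i − x_j) · ∏_{i=1}^n (1 − a·x_i·q^{k_i+|k|})/(1 − a·x_i) · ∏_{i,j=1}^n (c_j·x_i/x_j; q)_{k_i}/(q·x_i/x_j; q)_{k_i} · ∏_{i=1}^n (a·x_i; q)_{|k|}·(b·x_i; q)_{k_i} / [ (a·x_i·q/c_i; q)_{|k|}·(a·x_i·q^{1+N}; q)_{k_i} ] · (q^{−N}; q)_{|k|}/(a·q/b; q)_{|k|} · (a·q^{1+N}/(b·c_1⋯c_n))^{|k|} ] = (a·q/(b·c_1⋯c_n); q)_N/(a·q/b; q)_N · ∏_{i=1}^n (a·x_i·q; q)_N/(a·x_i·q/c_i; q)_N. -/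

import Mathlib

open Finset

/-- The q-shifted factorial `(a;q)_k`. -/
noncomputable def qPoch (q a : ℂ) (k : ℕ) : ℂ := ∏ i ∈ Finset.range k, (1 - a * q ^ i)

/-- The partial fraction expansion behind the case `N = 1` of Milne's fundamental theorem. -/
theorem sum_partialFraction {ι : Type*} [Fintype ι] [DecidableEq ι] (α w : ι → ℂ)
    (hw : ∀ i, w i ≠ 0) (hwd : Function.Injective w) :
    ∑ p, (1 - α p) * ∏ j ∈ univ.erase p, (w j - α j * w p) / (w j - w p) = 1 - ∏ j, α j := by
  let v : Option ι → ℂ := fun o => o.elim 0 w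
  have hv : Set.InjOn v (univ : Finset (Option ι)) := by
    rintro (_ | i) _ (_ | j) _ h
    · rfl
    · exact absurd h.symm (hw j)
    · exact absurd h (hw i)
    · exact congrArg some (hwd h)
  let P : Polynomial ℂ := ∏ j, (Polynomial.C (-α j) * Polynomial.X + Polynomial.C (w j))
  have hlin (j : ι) :
      (Polynomial.C (-α j) * Polynomial.X + Polynomial.C (w j)).natDegree ≤ 1 :=
    Polynomial.natDegree_linear_le
  have hdeg : P.natDegree ≤ Fintype.card ι := by
    refine (Polynomial.natDegree_prod_le _ _).trans ?_
    refine (Finset.sum_le_sum fun j _ => hlin j).trans ?_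
    simp
  have hdeg' : P.degree < #(univ : Finset (Option ι)) := by
    refine Polynomial.degree_le_natDegree.trans_lt ?_
    rw [Finset.card_univ, Fintype.card_option]
    exact_mod_cast Nat.lt_succ_of_le hdeg
  have h := Lagrange.coeff_eq_sum hv hdeg'
  have hcoeff : P.coeff (#(univ : Finset (Option ι)) - 1) = ∏ j, (-α j) := by
    rw [Finset.card_univ, Fintype.card_option, Nat.add_sub_cancel]
    have := Polynomial.coeff_prod_of_natDegree_le
      (fun j => Polynomial.C (-α j) * Polynomial.X + Polynomial.C (w j)) 1 (s := univ)
      (fun j _ => hlin j)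
    rw [Finset.card_univ, mul_one] at this
    rw [this]
    simp [Polynomial.coeff_C]
  have heval (t : ℂ) : P.eval t = ∏ j, (w j - α j * t) := by
    simp only [P, Polynomial.eval_prod]
    exact Finset.prod_congr rfl fun j _ => by simp; ring
  have hnone : (univ : Finset (Option ι)).erase none = univ.map Function.Embedding.some := by
    ext o; cases o <;> simp
  have hsome (p : ι) : (univ : Finset (Option ι)).erase (some p) =
      insert none ((univ.erase p).map Function.Embedding.some) := by
    ext o; cases o <;> simp
  rw [hcoeff, Fintype.sum_option, hnone, Finset.prod_map] at h
  simp only [heval, v, Option.elim, Function.Embedding.some_apply, hsome, mul_zero, sub_zero,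
    zero_sub] at h
  have hterm (p : ι) : (∏ j, (w j - α j * w p)) /
      ∏ o ∈ insert none ((univ.erase p).map Function.Embedding.some),
        (w p - (Option.elim o 0 w)) =
      -((1 - α p) * ∏ j ∈ univ.erase p, (w j - α j * w p) / (w j - w p)) *
        (-1) ^ Fintype.card ι := by
    rw [Finset.prod_insert (by simp), Finset.prod_map]
    simp only [Option.elim, Function.Embedding.some_apply, sub_zero]
    rw [← Finset.mul_prod_erase univ _ (mem_univ p), Finset.prod_div_distrib]
    have h1 : ∏ j ∈ univ.erase p, (w p - w j) =
        (-1) ^ (Fintype.card ι - 1) * ∏ j ∈ univ.erase p, (w j - w p) := by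
      rw [← Finset.card_univ, ← Finset.card_erase_of_mem (mem_univ p), ← Finset.prod_const,
        ← Finset.prod_mul_distrib]
      exact Finset.prod_congr rfl fun j _ => by ring
    have h2 : (-1 : ℂ) ^ Fintype.card ι = -(-1) ^ (Fintype.card ι - 1) := by
      obtain ⟨m, hm⟩ := Nat.exists_eq_succ_of_ne_zero 
        (Fintype.card_pos_iff.2 ⟨p⟩).ne'
      rw [hm, Nat.succ_sub_one, pow_succ]; ring
    have h3 : ∏ j ∈ univ.erase p, (w j - w p) ≠ 0 :=
      Finset.prod_ne_zero_iff.2 fun j hj =>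
        sub_ne_zero.2 fun e => Finset.ne_of_mem_erase hj (hwd e)
    rw [h1, h2]
    have h4 : ((-1 : ℂ) ^ (Fintype.card ι - 1)) * (-1) ^ (Fintype.card ι - 1) = 1 := by
      rw [← mul_pow]; simp
    have h5 : (-1 : ℂ) ^ (Fintype.card ι - 1) ≠ 0 := by simp
    have := hw p
    generalize ∏ j ∈ univ.erase p, (w j - α j * w p) = X
    field_simp
    linear_combination (1 - α p) * X * (-h4)
  simp only [Option.elim] at hterm
  rw [Finset.sum_congr rfl fun p _ => hterm p, ← Finset.sum_mul, Finset.sum_neg_distrib,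
    Finset.prod_neg, Finset.prod_neg, Finset.card_univ] at h
  have h0 : ∏ j, w j ≠ 0 := Finset.prod_ne_zero_iff.2 fun j _ => hw j
  have h4 : ((-1 : ℂ) ^ Fintype.card ι) * (-1) ^ Fintype.card ι = 1 := by
    rw [← mul_pow]; simp
  have h5 : (-1 : ℂ) ^ Fintype.card ι ≠ 0 := by simp
  have h6 : (∏ j, w j) / ((-1 : ℂ) ^ Fintype.card ι * ∏ j, w j) = (-1) ^ Fintype.card ι := by
    rw [div_eq_iff (mul_ne_zero h5 h0), ← mul_assoc, h4, one_mul]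
  rw [h6] at h
  refine mul_left_cancel₀ h5 ?_
  linear_combination h

theorem qPoch_zero (q a : ℂ) : qPoch q a 0 = 1 := by simp [qPoch]

theorem qPoch_succ (q a : ℂ) (k : ℕ) : qPoch q a (k + 1) = qPoch q a k * (1 - a * q ^ k) :=
  Finset.prod_range_succ _ _

theorem qPoch_succ' (q a : ℂ) (k : ℕ) :
    qPoch q a (k + 1) = (1 - a) * qPoch q (a * q) k := by
  simp only [qPoch]
  rw [Finset.prod_range_succ', mul_comm]
  congr 1
  · simp
  · exact Finset.prod_congr rfl fun i _ => by ring

theorem qPoch_ne_zero {q a : ℂ} {k : ℕ} (h : ∀ i < k, a * q ^ i ≠ 1) : qPoch q a k ≠ 0 :=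
  Finset.prod_ne_zero_iff.2 fun i hi => sub_ne_zero.2 (h i (Finset.mem_range.1 hi)).symm

theorem mul_pow_ne_one_of_qPoch_ne_zero {q a : ℂ} {k i : ℕ} (h : qPoch q a k ≠ 0) (hi : i < k) :
    a * q ^ i ≠ 1 :=
  fun e => Finset.prod_ne_zero_iff.1 h i (Finset.mem_range.2 hi) (by rw [e, sub_self])

theorem prod_prod_ite_lt_eq {m : ℕ} (p : Fin m) (g : Fin m → Fin m → ℂ)
    (hg : ∀ i j, g i j = g j i) :
    (∏ i, ∏ j, if i < j then g i j else 1) = (∏ j ∈ univ.erase p, g p j) *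
      ∏ i ∈ univ.erase p, ∏ j ∈ univ.erase p, if i < j then g i j else 1 := by
  rw [← Finset.mul_prod_erase univ _ (mem_univ p),
    ← Finset.mul_prod_erase univ (fun j => if p < j then g p j else 1) (mem_univ p)]
  simp_rw [fun i => (Finset.mul_prod_erase univ (fun j => if i < j then g i j else 1)
    (mem_univ p)).symm]
  rw [Finset.prod_mul_distrib, ← mul_assoc]
  congr 1
  rw [if_neg (lt_irrefl p), one_mul, ← Finset.prod_mul_distrib]
  refine Finset.prod_congr rfl fun j hj => ?_
  rcases lt_or_gt_of_ne (Finset.ne_of_mem_erase hj) with h | h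
  · rw [if_neg h.not_gt, if_pos h, one_mul, hg]
  · rw [if_neg h.not_gt, if_pos h, mul_one]

/-- The summand of Milne's fundamental theorem of `U(m)` series. -/
noncomputable def milneTerm {m : ℕ} (q : ℂ) (a z : Fin m → ℂ) (k : Fin m → ℕ) : ℂ :=
  (∏ i, ∏ j, if i < j then (z i * q ^ k i - z j * q ^ k j) / (z i - z j) else 1) *
    ∏ i, ∏ j, qPoch q (a j * z i / z j) (k i) / qPoch q (q * z i / z j) (k i)

theorem milneTerm_update {m : ℕ} {q : ℂ} (a z : Fin m → ℂ) (l : Fin m → ℕ) (p : Fin m)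
    (hz : ∀ i, z i ≠ 0) (hp : q ^ (l p + 1) ≠ 1)
    (h₀ : ∀ j ≠ p, z j * q ^ l j ≠ z p * q ^ l p)
    (h₁ : ∀ j ≠ p, z j * q ^ l j ≠ z p * q ^ (l p + 1))
    (h₂ : ∀ j ≠ p, z j ≠ z p * q ^ (l p + 1)) :
    milneTerm q a z (Function.update l p (l p + 1)) * ((1 - q ^ (l p + 1)) *
      ∏ j ∈ univ.erase p, (z j * q ^ l j - q ^ l j * (z p * q ^ (l p + 1))) /
        (z j * q ^ l j - z p * q ^ (l p + 1))) =
    milneTerm q a z l * ((1 - a p * q ^ l p) *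
      ∏ j ∈ univ.erase p, (z j * q ^ l j - a j * q ^ l j * (z p * q ^ l p)) /
        (z j * q ^ l j - z p * q ^ l p)) := by
  have hsymm (k : Fin m → ℕ) (i j : Fin m) : (z i * q ^ k i - z j * q ^ k j) / (z i - z j) =
      (z j * q ^ k j - z i * q ^ k i) / (z j - z i) := by
    rw [← neg_sub, ← neg_sub (z j), neg_div_neg_eq]
  unfold milneTerm
  rw [prod_prod_ite_lt_eq p _ (hsymm _), prod_prod_ite_lt_eq p _ (hsymm _)]
  set l' := Function.update l p (l p + 1) with hl'
  have hlp : l' p = l p + 1 := by simp [hl']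
  have hlj : ∀ j ∈ univ.erase p, l' j = l j := fun j hj => by
    simp [hl', Finset.ne_of_mem_erase hj]
  have hR : (∏ i ∈ univ.erase p, ∏ j ∈ univ.erase p,
        if i < j then (z i * q ^ l' i - z j * q ^ l' j) / (z i - z j) else 1) =
      ∏ i ∈ univ.erase p, ∏ j ∈ univ.erase p,
        if i < j then (z i * q ^ l i - z j * q ^ l j) / (z i - z j) else 1 :=
    Finset.prod_congr rfl fun i hi => Finset.prod_congr rfl fun j hj => by
      rw [hlj i hi, hlj j hj]
  rw [hR]
  rw [← Finset.mul_prod_erase univ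
      (fun i => ∏ j, qPoch q (a j * z i / z j) (l' i) / qPoch q (q * z i / z j) (l' i))
      (mem_univ p),
    ← Finset.mul_prod_erase univ
      (fun i => ∏ j, qPoch q (a j * z i / z j) (l i) / qPoch q (q * z i / z j) (l i))
      (mem_univ p)]
  have hR' : (∏ i ∈ univ.erase p,
        ∏ j, qPoch q (a j * z i / z j) (l' i) / qPoch q (q * z i / z j) (l' i)) =
      ∏ i ∈ univ.erase p,
        ∏ j, qPoch q (a j * z i / z j) (l i) / qPoch q (q * z i / z j) (l i) :=
    Finset.prod_congr rfl fun i hi => by rw [hlj i hi]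
  rw [hR', hlp]
  have hV : ∏ j ∈ univ.erase p, (z p * q ^ (l p + 1) - z j * q ^ l' j) / (z p - z j) =
      ∏ j ∈ univ.erase p, (z p * q ^ (l p + 1) - z j * q ^ l j) / (z p - z j) :=
    Finset.prod_congr rfl fun j hj => by rw [hlj j hj]
  rw [hV]
  simp only [qPoch_succ, mul_div_mul_comm, Finset.prod_mul_distrib]
  rw [← Finset.mul_prod_erase univ
    (fun j => (1 - a j * z p / z j * q ^ l p) / (1 - q * z p / z j * q ^ l p)) (mem_univ p)]
  have hpp : (1 - a p * z p / z p * q ^ l p) / (1 - q * z p / z p * q ^ l p) *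
      (1 - q ^ (l p + 1)) = 1 - a p * q ^ l p := by
    rw [mul_div_cancel_right₀ _ (hz p), mul_div_cancel_right₀ _ (hz p), ← pow_succ',
      div_mul_cancel₀ _ (sub_ne_zero.2 hp.symm)]
  have key : (∏ j ∈ univ.erase p, (z p * q ^ (l p + 1) - z j * q ^ l j) / (z p - z j)) *
      (∏ j ∈ univ.erase p, (1 - a j * z p / z j * q ^ l p) / (1 - q * z p / z j * q ^ l p)) *
      (∏ j ∈ univ.erase p, (z j * q ^ l j - q ^ l j * (z p * q ^ (l p + 1))) /
        (z j * q ^ l j - z p * q ^ (l p + 1))) =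
      (∏ j ∈ univ.erase p, (z p * q ^ l p - z j * q ^ l j) / (z p - z j)) *
      ∏ j ∈ univ.erase p, (z j * q ^ l j - a j * q ^ l j * (z p * q ^ l p)) /
        (z j * q ^ l j - z p * q ^ l p) := by
    rw [← Finset.prod_mul_distrib, ← Finset.prod_mul_distrib, ← Finset.prod_mul_distrib]
    refine Finset.prod_congr rfl fun j hj => ?_
    have hjp := Finset.ne_of_mem_erase hj
    have e₀ := sub_ne_zero.2 (h₀ j hjp)
    have e₁ := sub_ne_zero.2 (h₁ j hjp)
    have e₂ := sub_ne_zero.2 (h₂ j hjp)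
    have e₃ := hz j
    have s₀ : (z p * q ^ l p - z j * q ^ l j) / (z p - z j) *
        ((z j * q ^ l j - a j * q ^ l j * (z p * q ^ l p)) / (z j * q ^ l j - z p * q ^ l p)) =
        -(z j * q ^ l j - a j * q ^ l j * (z p * q ^ l p)) / (z p - z j) := by
      rw [← neg_sub (z j * q ^ l j) (z p * q ^ l p)]
      field_simp
    have s₁ : 1 - q * z p / z j * q ^ l p = (z j - z p * q ^ (l p + 1)) / z j := by
      field_simp
      ring
    rw [s₀, s₁, ← neg_sub (z j * q ^ l j) (z p * q ^ (l p + 1))]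
    field_simp
  linear_combination (∏ i ∈ univ.erase p, ∏ j ∈ univ.erase p,
        if i < j then (z i * q ^ l i - z j * q ^ l j) / (z i - z j) else 1) *
    (∏ j, qPoch q (a j * z p / z j) (l p) / qPoch q (q * z p / z j) (l p)) *
    (∏ i ∈ univ.erase p,
        ∏ j, qPoch q (a j * z i / z j) (l i) / qPoch q (q * z i / z j) (l i)) * (
     ((∏ j ∈ univ.erase p, (z p * q ^ (l p + 1) - z j * q ^ l j) / (z p - z j)) *
      (∏ j ∈ univ.erase p, (1 - a j * z p / z j * q ^ l p) / (1 - q * z p / z j * q ^ l p)) *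
      (∏ j ∈ univ.erase p, (z j * q ^ l j - q ^ l j * (z p * q ^ (l p + 1))) /
        (z j * q ^ l j - z p * q ^ (l p + 1)))) * hpp + (1 - a p * q ^ l p) * key)

/-- Milne's fundamental theorem of `U(m)` series. -/
theorem sum_milneTerm {m : ℕ} {q : ℂ} (hq : q ≠ 0) (hqru : ∀ r : ℕ, 0 < r → q ^ r ≠ 1)
    (a z : Fin m → ℂ) (hz : ∀ i, z i ≠ 0) (N : ℕ)
    (hzd : ∀ i j, i ≠ j → ∀ r s, r + s ≤ N → z i * q ^ r ≠ z j * q ^ s) :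
    ∑ k ∈ piAntidiag univ N, milneTerm q a z k = qPoch q (∏ i, a i) N / qPoch q q N := by
  induction N with
  | zero =>
    have hV : (∏ i, ∏ j, if i < j then (z i - z j) / (z i - z j) else 1) = 1 :=
      Finset.prod_eq_one fun i _ => Finset.prod_eq_one fun j _ => by
        split_ifs with hij
        · exact div_self (sub_ne_zero.2 (by simpa using hzd i j hij.ne 0 0 le_rfl))
        · rfl
    simp [milneTerm, qPoch_zero, hV]
  | succ N ih =>
    specialize ih fun i j hij r s h => hzd i j hij r s (by omega)
    have hinj (k : Fin m → ℕ) (M : ℕ) (hM : M ≤ N + 1) (hk : k ∈ piAntidiag univ M) :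
        Function.Injective fun i => z i * q ^ k i := by
      intro i j hij
      by_contra hne
      refine hzd i j hne (k i) (k j) ?_ hij
      have : k i + k j ≤ ∑ i, k i := by
        rw [← Finset.sum_pair (f := k) hne]
        exact Finset.sum_le_sum_of_subset (Finset.subset_univ _)
      have : ∑ i, k i = M := (mem_piAntidiag.1 hk).1
      omega
    have hz' (k : Fin m → ℕ) (i : Fin m) : z i * q ^ k i ≠ 0 :=
      mul_ne_zero (hz i) (pow_ne_zero _ hq)
    have hL : ∀ k ∈ piAntidiag univ (N + 1), milneTerm q a z k * (1 - q ^ (N + 1)) =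
        ∑ p, milneTerm q a z k * ((1 - q ^ k p) * ∏ j ∈ univ.erase p,
          (z j * q ^ k j - q ^ k j * (z p * q ^ k p)) / (z j * q ^ k j - z p * q ^ k p)) := by
      intro k hk
      rw [← Finset.mul_sum, sum_partialFraction (fun i => q ^ k i) (fun i => z i * q ^ k i)
        (hz' k) (hinj k _ le_rfl hk), Finset.prod_pow_eq_pow_sum, (mem_piAntidiag.1 hk).1]
    have hR : ∀ l ∈ piAntidiag univ N, milneTerm q a z l * (1 - (∏ i, a i) * q ^ N) =
        ∑ p, milneTerm q a z l * ((1 - a p * q ^ l p) * ∏ j ∈ univ.erase p,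
          (z j * q ^ l j - a j * q ^ l j * (z p * q ^ l p)) /
            (z j * q ^ l j - z p * q ^ l p)) := by
      intro k hk
      rw [← Finset.mul_sum, sum_partialFraction (fun i => a i * q ^ k i)
        (fun i => z i * q ^ k i) (hz' k) (hinj k _ (Nat.le_succ N) hk),
        Finset.prod_mul_distrib, Finset.prod_pow_eq_pow_sum, (mem_piAntidiag.1 hk).1]
    have hstep : (∑ k ∈ piAntidiag univ (N + 1), milneTerm q a z k) * (1 - q ^ (N + 1)) =
        (∑ l ∈ piAntidiag univ N, milneTerm q a z l) * (1 - (∏ i, a i) * q ^ N) := by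
      rw [Finset.sum_mul, Finset.sum_mul, Finset.sum_congr rfl hL, Finset.sum_congr rfl hR,
        Finset.sum_comm, Finset.sum_comm (s := piAntidiag univ N)]
      refine Finset.sum_congr rfl fun p _ => ?_
      symm
      refine Finset.sum_of_injOn (fun l => Function.update l p (l p + 1)) ?_ ?_ ?_ ?_
      · intro l _ l' _ h
        funext i
        have := congrFun h i
        by_cases hi : i = p
        · subst hi; simpa using this
        · simpa [hi] using this
      · intro l hl
        have hl := (mem_piAntidiag.1 hl).1
        simp only [Finset.mem_coe, mem_piAntidiag, mem_univ, implies_true, and_true]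
        rw [Finset.sum_update_of_mem (mem_univ p), ← hl, Finset.sdiff_singleton_eq_erase,
          ← Finset.add_sum_erase univ l (mem_univ p)]
        ring
      · intro k hk hk'
        have : k p = 0 := by
          by_contra h0
          refine hk' ⟨Function.update k p (k p - 1), ?_, ?_⟩
          · have hk := (mem_piAntidiag.1 hk).1
            simp only [Finset.mem_coe, mem_piAntidiag, mem_univ, implies_true, and_true]
            rw [Finset.sum_update_of_mem (mem_univ p), Finset.sdiff_singleton_eq_erase]
            rw [← Finset.add_sum_erase univ k (mem_univ p)] at hk
            omega
          · funext i
            by_cases hi : i = p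
            · subst hi; simp; omega
            · simp [hi]
        simp [this]
      · intro l hl
        have hlp : l p ≤ N := by
          rw [← (mem_piAntidiag.1 hl).1]
          exact Finset.single_le_sum (fun _ _ => Nat.zero_le _) (mem_univ p)
        have hlj (j : Fin m) (hj : j ≠ p) : l j + l p ≤ N := by
          rw [← (mem_piAntidiag.1 hl).1, ← Finset.sum_pair (f := l) hj]
          exact Finset.sum_le_sum_of_subset (Finset.subset_univ _)
        rw [← milneTerm_update a z l p hz (hqru _ (Nat.succ_pos _))
          (fun j hj => hzd j p hj _ _ (by have := hlj j hj; omega))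
          (fun j hj => hzd j p hj _ _ (by have := hlj j hj; omega))
          (fun j hj => by simpa using hzd j p hj 0 (l p + 1) (by omega))]
        simp only [Function.update_self]
        congr 2
        refine Finset.prod_congr rfl fun j hj => ?_
        rw [Function.update_of_ne (Finset.ne_of_mem_erase hj)]
    have h1 : 1 - q ^ (N + 1) ≠ 0 := sub_ne_zero.2 (hqru _ (Nat.succ_pos N)).symm
    rw [qPoch_succ, qPoch_succ, ← pow_succ', mul_div_mul_comm, ← ih, ← mul_div_assoc,
      eq_div_iff h1, hstep]

theorem qPoch_add (q a : ℂ) (s k : ℕ) :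
    qPoch q a (s + k) = qPoch q a s * qPoch q (a * q ^ s) k := by
  simp only [qPoch, Finset.prod_range_add]
  congr 1
  exact Finset.prod_congr rfl fun i _ => by ring

theorem qPoch_ne_zero_of_le {q a : ℂ} {k m : ℕ} (h : qPoch q a k ≠ 0) (hm : m ≤ k) :
    qPoch q a m ≠ 0 :=
  qPoch_ne_zero fun _ hi => mul_pow_ne_one_of_qPoch_ne_zero h (hi.trans_le hm)

theorem qPoch_reverse {q u w : ℂ} {k : ℕ} (h : u * w * q ^ k = q) (hq : q ≠ 0) :
    qPoch q u k = u ^ k * (∏ i ∈ range k, -q ^ i) * qPoch q w k := by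
  simp only [qPoch]
  rw [← Finset.prod_range_reflect (fun i => 1 - w * q ^ i), ← Finset.card_range k,
    ← Finset.prod_const, Finset.card_range, ← Finset.prod_mul_distrib,
    ← Finset.prod_mul_distrib]
  refine Finset.prod_congr rfl fun i hi => ?_
  have hk : q ^ k = q * (q ^ i * q ^ (k - 1 - i)) := by
    rw [← pow_add, ← pow_succ']
    congr 1
    have := Finset.mem_range.1 hi
    omega
  rw [hk] at h
  have h' : u * w * (q ^ i * q ^ (k - 1 - i)) = 1 := by
    refine mul_left_cancel₀ hq ?_
    linear_combination h
  linear_combination -h'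

theorem qPoch_div_qPoch_reverse {q u w u' w' : ℂ} {k : ℕ} (hq : q ≠ 0)
    (h : u * w * q ^ k = q) (h' : u' * w' * q ^ k = q) :
    qPoch q u k / qPoch q u' k = (u / u') ^ k * (qPoch q w k / qPoch q w' k) := by
  rw [qPoch_reverse h hq, qPoch_reverse h' hq, mul_div_mul_comm, div_pow, mul_div_mul_right]
  exact Finset.prod_ne_zero_iff.2 fun i _ => neg_ne_zero.2 (pow_ne_zero _ hq)

theorem qPoch_div_qPoch_reverse_add {q u v u' v' : ℂ} {s k : ℕ} (hq : q ≠ 0)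
    (h : u * v * q ^ (s + k) = q) (h' : u' * v' * q ^ (s + k) = q)
    (hv : qPoch q v s ≠ 0) (hv' : qPoch q v' s ≠ 0) :
    qPoch q u k / qPoch q u' k = (u / u') ^ k *
      (qPoch q v (s + k) / qPoch q v' (s + k)) * (qPoch q v' s / qPoch q v s) := by
  rw [pow_add] at h h'
  rw [qPoch_div_qPoch_reverse (w := v * q ^ s) (w' := v' * q ^ s) hq
    (by linear_combination h) (by linear_combination h'), qPoch_add, qPoch_add,
    mul_div_mul_comm]
  field_simp

/-- The summand of the terminating `A_n` very-well-poised `₆φ₅` series. -/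
noncomputable def sixPhiFiveTerm {n : ℕ} (N : ℕ) (q a b : ℂ) (c x : Fin n → ℂ)
    (k : Fin n → ℕ) : ℂ :=
  (∏ i, ∏ j, if i < j then (x i * q ^ k i - x j * q ^ k j) / (x i - x j) else 1) *
    (∏ i, (1 - a * x i * q ^ (k i + ∑ j, k j)) / (1 - a * x i)) *
    (∏ i, ∏ j, qPoch q (c j * x i / x j) (k i) / qPoch q (q * x i / x j) (k i)) *
    (∏ i, (qPoch q (a * x i) (∑ j, k j) * qPoch q (b * x i) (k i)) /
      (qPoch q (a * x i * q / c i) (∑ j, k j) * qPoch q (a * x i * q ^ (1 + N)) (k i))) *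
    (qPoch q (q ^ (-(N : ℤ))) (∑ j, k j) / qPoch q (a * q / b) (∑ j, k j)) *
    (a * q ^ (1 + N) / (b * ∏ i, c i)) ^ (∑ j, k j)

theorem qPoch_zpow_neg_ne_zero {q : ℂ} (hq : q ≠ 0) (hqru : ∀ m : ℕ, 0 < m → q ^ m ≠ 1)
    (N : ℕ) : qPoch q (q ^ (-(N : ℤ))) N ≠ 0 := by
  refine qPoch_ne_zero fun i hi h => hqru (N - i) (by omega) ?_
  rw [zpow_neg, zpow_natCast, inv_mul_eq_one₀ (pow_ne_zero _ hq)] at h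
  refine mul_right_cancel₀ (pow_ne_zero i hq) ?_
  rw [← pow_add, Nat.sub_add_cancel hi.le, h, one_mul]

theorem milneTerm_snoc {n N : ℕ} {q : ℂ} (hq : q ≠ 0) (hqru : ∀ m : ℕ, 0 < m → q ^ m ≠ 1)
    {a b : ℂ} {c x : Fin n → ℂ} (ha : a ≠ 0) (hb : b ≠ 0) (hc : ∀ i, c i ≠ 0)
    (hx : ∀ i, x i ≠ 0) (hgen : ∀ i, ∀ e ≤ N, a * x i * q ^ e ≠ 1)
    (hden : ∀ i, qPoch q (a * x i * q / c i) N ≠ 0) (hden' : qPoch q (a * q / b) N ≠ 0)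
    (k : Fin n → ℕ) {M : ℕ} (hk : (∑ i, k i) + M = N) :
    milneTerm q (Fin.snoc c (b / (a * q ^ N)) : Fin (n + 1) → ℂ)
        (Fin.snoc (fun i => a * x i * q ^ N) 1 : Fin (n + 1) → ℂ)
        (Fin.snoc k M : Fin (n + 1) → ℕ) =
      ((∏ i, qPoch q (a * x i * q / c i) N / qPoch q (a * x i * q) N) *
        (qPoch q (a * q / b) N / qPoch q (q ^ (-(N : ℤ))) N) *
        ((b * ∏ i, c i) / (a * q ^ (1 + N))) ^ N) * sixPhiFiveTerm N q a b c x k := by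
  have hqN : q ^ N ≠ 0 := pow_ne_zero _ hq
  unfold milneTerm sixPhiFiveTerm
  simp only [Fin.prod_univ_castSucc, Fin.snoc_castSucc, Fin.snoc_last, Fin.castSucc_lt_last,
    if_true, Fin.castSucc_lt_castSucc_iff, (Fin.castSucc_lt_last _).not_gt, if_false,
    lt_irrefl, Finset.prod_const_one, mul_one, div_one, one_mul]
  set s := ∑ i, k i with hs
  have hsN : s ≤ N := by omega
  have e₁ (i j : Fin n) : (a * x i * q ^ N * q ^ k i - a * x j * q ^ N * q ^ k j) /
      (a * x i * q ^ N - a * x j * q ^ N) = (x i * q ^ k i - x j * q ^ k j) / (x i - x j) := by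
    rw [← mul_div_mul_left (x i * q ^ k i - x j * q ^ k j) _ (mul_ne_zero ha hqN)]
    congr 1 <;> ring
  have e₂ (i : Fin n) : (a * x i * q ^ N * q ^ k i - q ^ M) / (a * x i * q ^ N - 1) =
      q ^ M * ((1 - a * x i) / (1 - a * x i * q ^ N)) *
        ((1 - a * x i * q ^ (k i + s)) / (1 - a * x i)) := by
    have h₀ : 1 - a * x i ≠ 0 :=
      sub_ne_zero.2 (by simpa using (hgen i 0 (Nat.zero_le _)).symm)
    have h₁ : 1 - a * x i * q ^ N ≠ 0 := sub_ne_zero.2 (hgen i N le_rfl).symm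
    rw [← neg_sub 1 (a * x i * q ^ N), ← hk]
    rw [← hk] at h₁
    field_simp
    ring
  have e₃ (t : ℂ) (i j : Fin n) : t * (a * x i * q ^ N) / (a * x j * q ^ N) =
      t * x i / x j := by
    have := hx j
    field_simp
  have e₄ (i : Fin n) : b / (a * q ^ N) * (a * x i * q ^ N) = b * x i := by field_simp
  have e₅ (i : Fin n) : q * (a * x i * q ^ N) = a * x i * q ^ (1 + N) := by ring
  have e₆ (j : Fin n) : qPoch q (c j / (a * x j * q ^ N)) M / qPoch q (q / (a * x j * q ^ N)) M =
      (c j / q) ^ M * (qPoch q (a * x j * q / c j) N / qPoch q (a * x j) N) *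
        (qPoch q (a * x j) s / qPoch q (a * x j * q / c j) s) := by
    have h₁ := hx j
    have h₂ := hc j
    rw [qPoch_div_qPoch_reverse_add (v := a * x j * q / c j) (v' := a * x j) (s := s) hq,
      hk]
    · congr 3
      field_simp
    · rw [hk]; field_simp
    · rw [hk]; field_simp
    · exact qPoch_ne_zero_of_le (hden j) hsN
    · exact qPoch_ne_zero fun e he => hgen j e (by omega)
  have e₇ : qPoch q (b / (a * q ^ N)) M / qPoch q q M =
      (b / (a * q ^ (1 + N))) ^ M *
        (qPoch q (a * q / b) N / qPoch q (q ^ (-(N : ℤ))) N) *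
        (qPoch q (q ^ (-(N : ℤ))) s / qPoch q (a * q / b) s) := by
    rw [qPoch_div_qPoch_reverse_add (v := a * q / b) (v' := q ^ (-(N : ℤ))) (s := s) hq, hk]
    · congr 3
      rw [div_div, mul_assoc, ← pow_succ, add_comm N]
    · rw [hk]; field_simp
    · rw [hk, zpow_neg, zpow_natCast]; field_simp
    · exact qPoch_ne_zero_of_le hden' hsN
    · exact qPoch_ne_zero_of_le (qPoch_zpow_neg_ne_zero hq hqru N) hsN
  have e₈ (i : Fin n) : (1 - a * x i) / (1 - a * x i * q ^ N) *
      (qPoch q (a * x i * q / c i) N / qPoch q (a * x i) N) =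
      qPoch q (a * x i * q / c i) N / qPoch q (a * x i * q) N := by
    have h₀ : 1 - a * x i ≠ 0 :=
      sub_ne_zero.2 (by simpa using (hgen i 0 (Nat.zero_le _)).symm)
    have h₂ : (1 - a * x i) * qPoch q (a * x i * q) N =
        (1 - a * x i * q ^ N) * qPoch q (a * x i) N := by
      rw [← qPoch_succ', qPoch_succ, mul_comm]
    rw [← mul_div_mul_comm, ← h₂, mul_div_mul_left _ _ h₀]
  have e₉ : (∏ _i : Fin n, q ^ M) * (∏ i, (c i / q) ^ M) * (b / (a * q ^ (1 + N))) ^ M =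
      ((b * ∏ i, c i) / (a * q ^ (1 + N))) ^ N *
        (a * q ^ (1 + N) / (b * ∏ i, c i)) ^ s := by
    have hC : ∏ i, c i ≠ 0 := Finset.prod_ne_zero_iff.2 fun i _ => hc i
    have h₁ : ((b * ∏ i, c i) / (a * q ^ (1 + N))) ^ N *
        (a * q ^ (1 + N) / (b * ∏ i, c i)) ^ s =
        ((b * ∏ i, c i) / (a * q ^ (1 + N))) ^ M := by
      rw [← hk, add_comm s, pow_add, mul_assoc, ← mul_pow]
      rw [div_mul_div_cancel₀ (by positivity), div_self (by positivity), one_pow, mul_one]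
    rw [h₁, ← Finset.prod_mul_distrib, mul_div_right_comm, mul_pow, mul_comm]
    congr 1
    rw [← Finset.prod_pow]
    refine Finset.prod_congr rfl fun i _ => ?_
    rw [← mul_pow, mul_div_cancel₀ _ hq]
  have e₁₀ (i : Fin n) : qPoch q (a * x i) s * qPoch q (b * x i) (k i) /
      (qPoch q (a * x i * q / c i) s * qPoch q (a * x i * q ^ (1 + N)) (k i)) =
      qPoch q (a * x i) s / qPoch q (a * x i * q / c i) s *
        (qPoch q (b * x i) (k i) / qPoch q (a * x i * q ^ (1 + N)) (k i)) :=
    mul_div_mul_comm _ _ _ _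
  simp only [e₁, e₂, e₃]
  simp only [e₄, e₅, e₆, e₇, ← e₈, e₁₀, Finset.prod_mul_distrib]
  linear_combination (∏ i, ∏ j, if i < j then
      (x i * q ^ k i - x j * q ^ k j) / (x i - x j) else 1) *
    (∏ i, (1 - a * x i) / (1 - a * x i * q ^ N)) *
    (∏ i, (1 - a * x i * q ^ (k i + s)) / (1 - a * x i)) *
    (∏ i, ∏ j, qPoch q (c j * x i / x j) (k i) / qPoch q (q * x i / x j) (k i)) *
    (∏ i, qPoch q (b * x i) (k i) / qPoch q (a * x i * q ^ (1 + N)) (k i)) *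
    (∏ i, qPoch q (a * x i * q / c i) N / qPoch q (a * x i) N) *
    (∏ i, qPoch q (a * x i) s / qPoch q (a * x i * q / c i) s) *
    (qPoch q (a * q / b) N / qPoch q (q ^ (-(N : ℤ))) N) *
    (qPoch q (q ^ (-(N : ℤ))) s / qPoch q (a * q / b) s) * e₉

theorem sum_sixPhiFiveTerm {n N : ℕ} {q : ℂ} (hq : q ≠ 0)
    (hqru : ∀ m : ℕ, 0 < m → q ^ m ≠ 1)
    {a b : ℂ} {c x : Fin n → ℂ} (ha : a ≠ 0) (hb : b ≠ 0) (hc : ∀ i, c i ≠ 0)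
    (hx : ∀ i, x i ≠ 0) (hgen : ∀ i, ∀ e ≤ 2 * N, a * x i * q ^ e ≠ 1)
    (hxd : ∀ i j, i ≠ j → ∀ r s, r + s ≤ N → x i * q ^ r ≠ x j * q ^ s)
    (hden : ∀ i, qPoch q (a * x i * q / c i) N ≠ 0) (hden' : qPoch q (a * q / b) N ≠ 0) :
    ∑ k ∈ Finset.filter (fun k : Fin n → ℕ => ∑ i, k i ≤ N)
        (Fintype.piFinset fun _ => Finset.range (N + 1)), sixPhiFiveTerm N q a b c x k =
      qPoch q (a * q / (b * ∏ i, c i)) N / qPoch q (a * q / b) N *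
        ∏ i, qPoch q (a * x i * q) N / qPoch q (a * x i * q / c i) N := by
  have hqN : q ^ N ≠ 0 := pow_ne_zero _ hq
  have hgen' : ∀ i, ∀ e ≤ N, a * x i * q ^ e ≠ 1 := fun i e he => hgen i e (by omega)
  have hlast : ∀ i, ∀ r s, r + s ≤ N → a * x i * q ^ N * q ^ r ≠ 1 * q ^ s := by
    intro i r s hrs h
    refine hgen i (N + r - s) (by omega) (mul_right_cancel₀ (pow_ne_zero s hq) ?_)
    rw [← h, mul_assoc, mul_assoc (a * x i), ← pow_add, ← pow_add, Nat.sub_add_cancel (by omega)]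
  have hM := sum_milneTerm hq hqru (Fin.snoc c (b / (a * q ^ N)) : Fin (n + 1) → ℂ)
    (Fin.snoc (fun i => a * x i * q ^ N) 1 : Fin (n + 1) → ℂ)
    (fun i => by
      refine Fin.lastCases ?_ (fun i => ?_) i
      · simp
      · simpa using ⟨⟨ha, hx i⟩, fun h => absurd h hq⟩) N
    (fun i j => by
      refine Fin.lastCases ?_ (fun i => ?_) i <;> refine Fin.lastCases ?_ (fun j => ?_) j
      · exact fun h => absurd rfl h
      · intro _ r s hrs
        simp only [Fin.snoc_castSucc, Fin.snoc_last]
        exact (hlast j s r (by omega)).symm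
      · intro _ r s hrs
        simp only [Fin.snoc_castSucc, Fin.snoc_last]
        exact hlast i r s hrs
      · intro hij r s hrs
        simp only [Fin.snoc_castSucc]
        intro h
        refine hxd i j (fun e => hij (by rw [e])) r s hrs
          (mul_left_cancel₀ (mul_ne_zero ha hqN) ?_)
        linear_combination h)
  have hsum : ∑ k ∈ piAntidiag univ N,
      milneTerm q (Fin.snoc c (b / (a * q ^ N)) : Fin (n + 1) → ℂ)
        (Fin.snoc (fun i => a * x i * q ^ N) 1 : Fin (n + 1) → ℂ) k =
      ∑ k ∈ Finset.filter (fun k : Fin n → ℕ => ∑ i, k i ≤ N)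
        (Fintype.piFinset fun _ => Finset.range (N + 1)),
        ((∏ i, qPoch q (a * x i * q / c i) N / qPoch q (a * x i * q) N) *
          (qPoch q (a * q / b) N / qPoch q (q ^ (-(N : ℤ))) N) *
          ((b * ∏ i, c i) / (a * q ^ (1 + N))) ^ N) * sixPhiFiveTerm N q a b c x k := by
    symm
    refine Finset.sum_bij' (fun k _ => (Fin.snoc k (N - ∑ i, k i) : Fin (n + 1) → ℕ))
      (fun l _ => Fin.init l) ?_ ?_ ?_ ?_ ?_
    · intro k hk
      have := (Finset.mem_filter.1 hk).2
      simp only [mem_piAntidiag, mem_univ, implies_true, and_true, Fin.sum_univ_castSucc,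
        Fin.snoc_castSucc, Fin.snoc_last]
      omega
    · intro l hl
      have h := (mem_piAntidiag.1 hl).1
      rw [Fin.sum_univ_castSucc] at h
      have h' : ∑ i, Fin.init l i ≤ N := by
        simp only [Fin.init]
        omega
      refine Finset.mem_filter.2 ⟨Fintype.mem_piFinset.2 fun i => ?_, h'⟩
      have := Finset.single_le_sum (f := Fin.init l) (fun _ _ => Nat.zero_le _) (mem_univ i)
      exact Finset.mem_range.2 (by omega)
    · intro k _
      exact Fin.init_snoc _ _
    · intro l hl
      have h := (mem_piAntidiag.1 hl).1
      rw [Fin.sum_univ_castSucc] at h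
      have h' : N - ∑ i, Fin.init l i = l (Fin.last n) := by
        simp only [Fin.init]
        omega
      simp only [h']
      exact Fin.snoc_init_self l
    · intro k hk
      have := (Finset.mem_filter.1 hk).2
      exact (milneTerm_snoc hq hqru ha hb hc hx hgen' hden hden' k (by omega)).symm
  have hC : ∏ i, c i ≠ 0 := Finset.prod_ne_zero_iff.2 fun i _ => hc i
  have hrhs : qPoch q (b / (a * q ^ N) * ∏ i, c i) N / qPoch q q N =
      ((b * ∏ i, c i) / (a * q ^ (1 + N))) ^ N *
        (qPoch q (a * q / (b * ∏ i, c i)) N / qPoch q (q ^ (-(N : ℤ))) N) := by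
    rw [qPoch_div_qPoch_reverse (w := a * q / (b * ∏ i, c i)) (w' := q ^ (-(N : ℤ))) hq]
    · congr 2
      field_simp
      ring
    · field_simp
    · rw [zpow_neg, zpow_natCast]; field_simp
  rw [hsum, ← Finset.mul_sum, Fin.prod_univ_castSucc] at hM
  simp only [Fin.snoc_castSucc, Fin.snoc_last] at hM
  rw [mul_comm (∏ i, c i), hrhs] at hM
  have h₁ := qPoch_zpow_neg_ne_zero hq hqru N
  have h₂ : ((b * ∏ i, c i) / (a * q ^ (1 + N))) ^ N ≠ 0 := by positivity
  have h₃ : ∏ i, qPoch q (a * x i * q / c i) N ≠ 0 :=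
    Finset.prod_ne_zero_iff.2 fun i _ => hden i
  have h₄ : ∏ i, qPoch q (a * x i * q) N ≠ 0 :=
    Finset.prod_ne_zero_iff.2 fun i _ => qPoch_ne_zero fun e he => by
      rw [mul_assoc _ q, ← pow_succ']
      exact hgen' i (e + 1) he
  rw [Finset.prod_div_distrib] at hM ⊢
  clear hsum hrhs hden
  generalize ∏ i, qPoch q (a * x i * q / c i) N = A at *
  generalize ∏ i, qPoch q (a * x i * q) N = B at *
  generalize qPoch q (a * q / (b * ∏ i, c i)) N = D at *
  generalize qPoch q (a * q / b) N = E at *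
  generalize ((b * ∏ i, c i) / (a * q ^ (1 + N))) ^ N = Y at *
  generalize ∑ k ∈ Finset.filter (fun k : Fin n → ℕ => ∑ i, k i ≤ N)
        (Fintype.piFinset fun _ => Finset.range (N + 1)), sixPhiFiveTerm N q a b c x k = S at *
  field_simp at hM ⊢
  linear_combination hM

theorem ContinuousAt.qPoch {X : Type*} [TopologicalSpace X] {f : X → ℂ} {t : X}
    (hf : ContinuousAt f t) (q : ℂ) (k : ℕ) : ContinuousAt (fun y => qPoch q (f y) k) t :=
  tendsto_finsetProd _ fun _ _ => continuousAt_const.sub (hf.mul continuousAt_const)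

theorem continuousAt_sixPhiFiveTerm {n N : ℕ} {q a b : ℂ} {c x : Fin n → ℂ} {k : Fin n → ℕ}
    (hb : b * ∏ i, c i ≠ 0) (hax : ∀ i, 1 - a * x i ≠ 0)
    (hden : ∀ i, qPoch q (a * x i * q / c i) (∑ j, k j) ≠ 0)
    (hden₁ : ∀ i, qPoch q (a * x i * q ^ (1 + N)) (k i) ≠ 0)
    (hden₂ : qPoch q (a * q / b) (∑ j, k j) ≠ 0) :
    ContinuousAt (fun a => sixPhiFiveTerm N q a b c x k) a := by
  unfold sixPhiFiveTerm
  refine ((((continuousAt_const.mul ?_).mul continuousAt_const).mul ?_).mul ?_).mul ?_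
  · exact tendsto_finsetProd _ fun i _ => ContinuousAt.div (by fun_prop) (by fun_prop) (hax i)
  · refine tendsto_finsetProd _ fun i _ => ContinuousAt.div ?_ ?_
      (mul_ne_zero (hden i) (hden₁ i))
    · exact (ContinuousAt.qPoch (by fun_prop) _ _).mul continuousAt_const
    · exact (ContinuousAt.qPoch (by fun_prop) _ _).mul (ContinuousAt.qPoch (by fun_prop) _ _)
  · exact continuousAt_const.div (ContinuousAt.qPoch (by fun_prop) _ _) hden₂
  · fun_prop

/-- Terminating `A_n` very-well-poised `₆φ₅` summation. -/
theorem stmt_4 (n : ℕ) (hn : 0 < n) (N : ℕ) (q : ℂ) (hq : q ≠ 0)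
    (hqru : ∀ m : ℕ, 0 < m → q ^ m ≠ 1)
    (a b : ℂ) (c x : Fin n → ℂ) (ha : a ≠ 0) (hb : b ≠ 0)
    (hc : ∀ i, c i ≠ 0) (hx : ∀ i, x i ≠ 0)
    (hxd : ∀ i j : Fin n, i ≠ j → x i ≠ x j)
    (hax : ∀ i, 1 - a * x i ≠ 0)
    (hden1 : ∀ i j : Fin n, ∀ m ≤ N, qPoch q (q * x i / x j) m ≠ 0)
    (hden2 : ∀ i : Fin n, ∀ m ≤ N, qPoch q (a * x i * q / c i) m ≠ 0)
    (hden3 : ∀ i : Fin n, ∀ m ≤ N, qPoch q (a * x i * q ^ (1 + N)) m ≠ 0)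
    (hden4 : ∀ m ≤ N, qPoch q (a * q / b) m ≠ 0) :
    ∑ k ∈ Finset.filter (fun k : Fin n → ℕ => ∑ i, k i ≤ N)
        (Fintype.piFinset fun _ => Finset.range (N + 1)),
      ((∏ i, ∏ j, if i < j then (x i * q ^ k i - x j * q ^ k j) / (x i - x j) else 1) *
        (∏ i, (1 - a * x i * q ^ (k i + ∑ j, k j)) / (1 - a * x i)) *
        (∏ i, ∏ j, qPoch q (c j * x i / x j) (k i) / qPoch q (q * x i / x j) (k i)) *
        (∏ i, (qPoch q (a * x i) (∑ j, k j) * qPoch q (b * x i) (k i)) /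
          (qPoch q (a * x i * q / c i) (∑ j, k j) * qPoch q (a * x i * q ^ (1 + N)) (k i))) *
        (qPoch q (q ^ (-(N : ℤ))) (∑ j, k j) / qPoch q (a * q / b) (∑ j, k j)) *
        (a * q ^ (1 + N) / (b * ∏ i, c i)) ^ (∑ j, k j)) =
      qPoch q (a * q / (b * ∏ i, c i)) N / qPoch q (a * q / b) N *
        ∏ i, qPoch q (a * x i * q) N / qPoch q (a * x i * q / c i) N := by
  have hC : ∏ i, c i ≠ 0 := Finset.prod_ne_zero_iff.2 fun i _ => hc i
  have hxd' : ∀ i j, i ≠ j → ∀ r s, r + s ≤ N → x i * q ^ r ≠ x j * q ^ s := by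
    have hlt (i j : Fin n) (m : ℕ) (h₀ : 0 < m) (hm : m ≤ N) : x i * q ^ m ≠ x j := by
      intro h
      refine mul_pow_ne_one_of_qPoch_ne_zero (hden1 i j N le_rfl)
        (i := m - 1) (by omega) ?_
      rw [div_mul_eq_mul_div, div_eq_one_iff_eq (hx j), ← h]
      obtain ⟨m, rfl⟩ := Nat.exists_eq_succ_of_ne_zero h₀.ne'
      rw [Nat.succ_sub_one, pow_succ]
      ring
    intro i j hij r s hrs h
    rcases lt_trichotomy r s with hl | rfl | hl
    · refine hlt j i (s - r) (by omega) (by omega)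
        (mul_right_cancel₀ (pow_ne_zero r hq) ?_)
      rw [h, mul_assoc, ← pow_add, Nat.sub_add_cancel hl.le]
    · exact hxd i j hij (mul_right_cancel₀ (pow_ne_zero r hq) h)
    · refine hlt i j (r - s) (by omega) (by omega)
        (mul_right_cancel₀ (pow_ne_zero s hq) ?_)
      rw [← h, mul_assoc, ← pow_add, Nat.sub_add_cancel hl.le]
  have hL : ContinuousAt (fun a => ∑ k ∈ Finset.filter (fun k : Fin n → ℕ => ∑ i, k i ≤ N)
      (Fintype.piFinset fun _ => Finset.range (N + 1)), sixPhiFiveTerm N q a b c x k) a := by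
    refine tendsto_finsetSum _ fun k hk => ?_
    have hk' := (Finset.mem_filter.1 hk).2
    exact continuousAt_sixPhiFiveTerm (mul_ne_zero hb hC) hax (fun i => hden2 i _ hk')
      (fun i => hden3 i _ ((Finset.single_le_sum (fun _ _ => Nat.zero_le _)
        (mem_univ i)).trans hk')) (hden4 _ hk')
  have hd (i : Fin n) : ContinuousAt (fun a => qPoch q (a * x i * q / c i) N) a :=
    ContinuousAt.qPoch (by fun_prop) _ _
  have hd' : ContinuousAt (fun a => qPoch q (a * q / b) N) a :=
    ContinuousAt.qPoch (by fun_prop) _ _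
  have hR : ContinuousAt (fun a => qPoch q (a * q / (b * ∏ i, c i)) N / qPoch q (a * q / b) N *
      ∏ i, qPoch q (a * x i * q) N / qPoch q (a * x i * q / c i) N) a :=
    ((ContinuousAt.qPoch (by fun_prop) _ _).div hd' (hden4 N le_rfl)).mul
      (tendsto_finsetProd _ fun i _ =>
        (ContinuousAt.qPoch (by fun_prop) _ _).div (hd i) (hden2 i N le_rfl))
  refine ((hL.eventuallyEq_nhds_iff_eventuallyEq_nhdsNE hR).1 ?_).eq_of_nhds
  have hne (t : ℂ) : ∀ᶠ y in nhdsWithin a {a}ᶜ, y ≠ t := by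
    by_cases h : a = t
    · subst h
      exact eventually_mem_nhdsWithin
    · exact (eventually_ne_nhds h).filter_mono nhdsWithin_le_nhds
  have hgen : ∀ᶠ y in nhdsWithin a {a}ᶜ, ∀ i, ∀ e ∈ range (2 * N + 1),
      y ≠ 1 / (x i * q ^ e) :=
    Filter.eventually_all.2 fun i => (Filter.eventually_all_finset _).2 fun e _ => hne _
  have hev : ∀ᶠ y in nhdsWithin a {a}ᶜ, ∀ i, qPoch q (y * x i * q / c i) N ≠ 0 :=
    Filter.eventually_all.2 fun i =>
      ((hd i).eventually_ne (hden2 i N le_rfl)).filter_mono nhdsWithin_le_nhds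
  filter_upwards [hne 0, hgen, hev,
    (hd'.eventually_ne (hden4 N le_rfl)).filter_mono nhdsWithin_le_nhds] with y h₁ h₂ h₃ h₄
  refine sum_sixPhiFiveTerm hq hqru h₁ hb hc hx (fun i e he h => ?_) hxd' h₃ h₄
  refine h₂ i e (Finset.mem_range.2 (by omega)) ?_
  rw [eq_div_iff (mul_ne_zero (hx i) (pow_ne_zero _ hq)), ← mul_assoc, h]
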